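/- Let k ≥ 2 and let F, F' be minimally unsatisfiable 2-clause-sets of deficiency k. Then F and F' are isomorphic as clause-sets if and only if their implication digraphs idg(F) and idg(F') are isomorphic as digraphs. -/

import Mathlib

/-- A literal: a variable (a natural number) together with a polarity. -/
abbrev Lit : Type := ℕ × Bool

/-- Complementation of literals: a fixed-point-free involution. -/
def Lit.compl (x : Lit) : Lit := (x.1, !x.2)

/-- The set of variables occurring in a clause-set. -/
def varsOf (F : Finset (Finset Lit)) : Finset ℕ := F.biUnion (fun C => C.image Prod.fst)

/-- The literals over the variables of `F` (both polarities). -/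
def litsOf (F : Finset (Finset Lit)) : Finset Lit := varsOf F ×ˢ (Finset.univ : Finset Bool)

/-- A clause is clash-free. -/
def IsClause (C : Finset Lit) : Prop := ∀ x ∈ C, Lit.compl x ∉ C

/-- A clause-set consists of clauses. -/
def IsClauseSet (F : Finset (Finset Lit)) : Prop := ∀ C ∈ F, IsClause C

/-- The truth value of a literal under a total assignment. -/
def LitVal (φ : ℕ → Bool) (x : Lit) : Bool := if x.2 then φ x.1 else !(φ x.1)

/-- Satisfiability of a clause-set. -/
def Sat (F : Finset (Finset Lit)) : Prop := ∃ φ : ℕ → Bool, ∀ C ∈ F, ∃ x ∈ C, LitVal φ x = true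

/-- Minimal unsatisfiability. -/
def MU (F : Finset (Finset Lit)) : Prop := IsClauseSet F ∧ ¬ Sat F ∧ ∀ G ⊂ F, Sat G

/-- Minimally unsatisfiable 2-clause-set. -/
def MU2 (F : Finset (Finset Lit)) : Prop := MU F ∧ ∀ C ∈ F, C.card ≤ 2

/-- The deficiency δ(F) = c(F) - n(F). -/
def deficiency (F : Finset (Finset Lit)) : ℤ := (F.card : ℤ) - ((varsOf F).card : ℤ)

/-- Literal-degree: number of clauses containing the literal. -/
def ldeg (F : Finset (Finset Lit)) (x : Lit) : ℕ := (F.filter (fun C => x ∈ C)).card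

/-- Variable-degree. -/
def vdeg (F : Finset (Finset Lit)) (v : ℕ) : ℕ := ldeg F (v, true) + ldeg F (v, false)

/-- Isomorphism of clause-sets: a bijection between the literals over the variables,
commuting with complementation, mapping one clause-set onto the other. -/
def CNFIso (F F' : Finset (Finset Lit)) (f : Lit → Lit) : Prop :=
  Set.BijOn f ↑(litsOf F) ↑(litsOf F') ∧
  (∀ x ∈ litsOf F, f (Lit.compl x) = Lit.compl (f x)) ∧
  F.image (fun C => C.image f) = F'

/-- A digraph: a finite vertex set and a finite set of arcs. -/
structure FinDigraph (α : Type) where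
  V : Finset α
  E : Finset (α × α)

/-- Well-formedness of a digraph: arcs join distinct vertices. -/
def FinDigraph.WellFormed {α : Type} (G : FinDigraph α) : Prop :=
  ∀ p ∈ G.E, p.1 ∈ G.V ∧ p.2 ∈ G.V ∧ p.1 ≠ p.2

/-- `f` is an isomorphism of digraphs from `G` to `G'`. -/
def DigraphIso {α β : Type} [DecidableEq β] (G : FinDigraph α) (G' : FinDigraph β) (f : α → β) : Prop :=
  Set.BijOn f ↑G.V ↑G'.V ∧ G.E.image (fun p => (f p.1, f p.2)) = G'.E

/-- The implication digraph of a 2-clause-set (without the empty clause):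
vertices are the literals over the variables of `F`, and there is an arc `(a,b)` iff
`{compl a} ∪ {b}` is a clause of `F` (this yields `(x̄,y),(ȳ,x)` for a clause `{x,y}`
and `(x̄,x)` for a unit-clause `{x}`). -/
def idg (F : Finset (Finset Lit)) : FinDigraph Lit :=
  ⟨litsOf F, (litsOf F ×ˢ litsOf F).filter (fun p => insert (Lit.compl p.1) {p.2} ∈ F)⟩

def FinDigraph.inDeg {α : Type} [DecidableEq α] (G : FinDigraph α) (v : α) : ℕ :=
  (G.E.filter (fun p => p.2 = v)).card

def FinDigraph.outDeg {α : Type} [DecidableEq α] (G : FinDigraph α) (v : α) : ℕ :=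
  (G.E.filter (fun p => p.1 = v)).card

/-- The standard double `m`-cycle. -/
def stdDoubleCycle (m : ℕ) : FinDigraph ℕ :=
  ⟨Finset.range m, (Finset.range m).biUnion (fun i => {(i, (i+1) % m), ((i+1) % m, i)})⟩

/-- A double `m`-cycle (`m ≥ 3`). -/
def IsDoubleCycle {α : Type} [DecidableEq α] (m : ℕ) (G : FinDigraph α) : Prop :=
  3 ≤ m ∧ ∃ f : ℕ → α, DigraphIso (stdDoubleCycle m) G f

/-- Splitting a vertex `x` into `u`, `v` with a new arc `(u,v)`:
arcs into `x` now go into `u`, arcs out of `x` now leave `v`. -/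
def SplitVertex {α : Type} [DecidableEq α] (G G' : FinDigraph α) : Prop :=
  ∃ x u v, x ∈ G.V ∧ u ∉ G.V ∧ v ∉ G.V ∧ u ≠ v ∧
    G'.V = insert u (insert v (G.V.erase x)) ∧
    G'.E = insert (u, v)
      ((G.E.filter (fun p => p.1 ≠ x ∧ p.2 ≠ x)) ∪
       ((G.E.filter (fun p => p.2 = x)).image (fun p => (p.1, u))) ∪
       ((G.E.filter (fun p => p.1 = x)).image (fun p => (v, p.2))))

/-- Splitting an arc `(x,y)` by a new (linear) vertex `v`. -/
def SplitArc {α : Type} [DecidableEq α] (G G' : FinDigraph α) : Prop :=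
  ∃ x y v, (x, y) ∈ G.E ∧ v ∉ G.V ∧
    G'.V = insert v G.V ∧
    G'.E = insert (x, v) (insert (v, y) (G.E.erase (x, y)))

/-- An `m`-weak-double-cycle: obtained from a double `m`-cycle by a finite sequence
of vertex splittings and arc splittings. -/
def IsWDC {α : Type} [DecidableEq α] (m : ℕ) (G : FinDigraph α) : Prop :=
  ∃ G₀ : FinDigraph α, IsDoubleCycle m G₀ ∧
    Relation.ReflTransGen (fun A B => SplitVertex A B ∨ SplitArc A B) G₀ G

/-- A digraph is nonlinear if no vertex has in-degree 1 and out-degree 1. -/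
def FinDigraph.Nonlinear {α : Type} [DecidableEq α] (G : FinDigraph α) : Prop :=
  ∀ v ∈ G.V, ¬ (G.inDeg v = 1 ∧ G.outDeg v = 1)

/-- Strong connectivity. -/
def StronglyConnected {α : Type} (G : FinDigraph α) : Prop :=
  ∀ a ∈ G.V, ∀ b ∈ G.V, Relation.ReflTransGen (fun x y => (x, y) ∈ G.E) a b

/-- A cycle digraph: strongly connected, at least 2 vertices, all vertices linear. -/
def IsCycleDigraph {α : Type} [DecidableEq α] (G : FinDigraph α) : Prop :=
  G.WellFormed ∧ 2 ≤ G.V.card ∧ StronglyConnected G ∧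
    ∀ v ∈ G.V, G.inDeg v = 1 ∧ G.outDeg v = 1

/-- A skew-symmetry of a digraph, as a permutation of its vertex set:
a fixed-point-free involution reversing arcs. -/
def IsSkewSym {α : Type} (G : FinDigraph α) (σ : Equiv.Perm {x // x ∈ G.V}) : Prop :=
  (∀ v, σ (σ v) = v) ∧ (∀ v, σ v ≠ v) ∧
  ∀ a b : {x // x ∈ G.V}, ((a : α), (b : α)) ∈ G.E → (((σ b : α)), ((σ a : α))) ∈ G.E

/-- A skew-symmetry has a unit if some vertex is joined by an arc to its image. -/
def HasUnit {α : Type} (G : FinDigraph α) (σ : Equiv.Perm {x // x ∈ G.V}) : Prop :=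
  ∃ v : {x // x ∈ G.V}, ((v : α), ((σ v : α))) ∈ G.E

/-- The literals over the variables of `F` are closed under complementation. -/
lemma compl_mem {F : Finset (Finset Lit)} {x : Lit} (h : x ∈ litsOf F) :
    Lit.compl x ∈ litsOf F := by
  simp only [litsOf, Lit.compl, Finset.mem_product] at h ⊢
  exact ⟨h.1, Finset.mem_univ _⟩

/-- Clause-set isomorphism, as an equivalence between the literals over the variables. -/
def CNFIsoE (F F' : Finset (Finset Lit))
    (e : {x // x ∈ litsOf F} ≃ {x // x ∈ litsOf F'}) : Prop :=
  (∀ x : {x // x ∈ litsOf F}, (e ⟨Lit.compl x.1, compl_mem x.2⟩ : Lit) = Lit.compl (e x : Lit)) ∧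
  F.image (fun C => C.image (fun y =>
      if h : y ∈ litsOf F then ((e ⟨y, h⟩ : {x // x ∈ litsOf F'}) : Lit) else y)) = F'

/-- An automorphism of a digraph, as a permutation of its vertex set preserving arcs. -/
def FinDigraphAut {α : Type} (G : FinDigraph α) (π : Equiv.Perm {x // x ∈ G.V}) : Prop :=
  ∀ a b : {x // x ∈ G.V}, ((a : α), (b : α)) ∈ G.E ↔ ((π a : α), (π b : α)) ∈ G.E

/-- Multiplicity of the edge between `u` and `v` in the underlying multigraph of a digraph. -/
def mult {α : Type} [DecidableEq α] (G : FinDigraph α) (u v : α) : ℕ :=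
  (if (u, v) ∈ G.E then 1 else 0) + (if (v, u) ∈ G.E then 1 else 0)

/-- `f` is an isomorphism between the underlying multigraphs of two digraphs. -/
def MultigraphIso {α β : Type} [DecidableEq α] [DecidableEq β]
    (G : FinDigraph α) (G' : FinDigraph β) (f : α → β) : Prop :=
  Set.BijOn f ↑G.V ↑G'.V ∧ ∀ u ∈ G.V, ∀ v ∈ G.V, mult G u v = mult G' (f u) (f v)

/-- `f` is an isomorphism between the underlying graphs of two digraphs. -/
def GraphIso {α β : Type} (G : FinDigraph α) (G' : FinDigraph β) (f : α → β) : Prop :=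
  Set.BijOn f ↑G.V ↑G'.V ∧ ∀ u ∈ G.V, ∀ v ∈ G.V,
    (((u, v) ∈ G.E ∨ (v, u) ∈ G.E) ↔ ((f u, f v) ∈ G'.E ∨ (f v, f u) ∈ G'.E))

/-- The transpose of a digraph: all arcs reversed. -/
def FinDigraph.transpose {α : Type} [DecidableEq α] (G : FinDigraph α) : FinDigraph α :=
  ⟨G.V, G.E.image (fun p => (p.2, p.1))⟩

/-- DP-reduction on variable `v`: replace all clauses containing `v` or `v̄` by all
their non-tautological resolvents on `v`. -/
def DP (v : ℕ) (F : Finset (Finset Lit)) : Finset (Finset Lit) :=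
  (F.filter (fun C => (v, true) ∉ C ∧ (v, false) ∉ C)) ∪
  ((((F.filter (fun C => (v, true) ∈ C)) ×ˢ (F.filter (fun C => (v, false) ∈ C))).image
      (fun p => (p.1.erase (v, true)) ∪ (p.2.erase (v, false)))).filter
    (fun C => ∀ x ∈ C, Lit.compl x ∉ C))

/-- A variable is singular if one of its literals has literal-degree 1. -/
def Singular (F : Finset (Finset Lit)) (v : ℕ) : Prop :=
  ldeg F (v, true) = 1 ∨ ldeg F (v, false) = 1

/-- The "middle part" `M_n = {{v̄_1,v_2},…,{v̄_{n−1},v_n}}`, with variables `1,…,n`. -/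
def Mn (n : ℕ) : Finset (Finset Lit) :=
  (Finset.Icc 1 (n - 1)).image (fun i => ({(i, false), (i + 1, true)} : Finset Lit))

def famU2 (n : ℕ) : Finset (Finset Lit) :=
  Mn n ∪ {({((1 : ℕ), true)} : Finset Lit), ({((n : ℕ), false)} : Finset Lit)}

def famU1 (n i : ℕ) : Finset (Finset Lit) :=
  Mn n ∪ {({((1 : ℕ), true)} : Finset Lit), ({((n : ℕ), false), ((i : ℕ), false)} : Finset Lit)}

def famU0s (n i : ℕ) : Finset (Finset Lit) :=
  Mn n ∪ {({((1 : ℕ), true), ((i : ℕ), true)} : Finset Lit),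
          ({((n : ℕ), false), ((i : ℕ), false)} : Finset Lit)}

def famU0 (n x y : ℕ) : Finset (Finset Lit) :=
  Mn n ∪ {({((1 : ℕ), true), ((x : ℕ), true)} : Finset Lit),
          ({((n : ℕ), false), ((y : ℕ), false)} : Finset Lit)}

/-- Membership in one of the four families (with the stated parameter ranges). -/
def InFam (G : Finset (Finset Lit)) : Prop :=
  (∃ n, 1 ≤ n ∧ G = famU2 n) ∨
  (∃ n i, 2 ≤ n ∧ 1 ≤ i ∧ i ≤ n - 1 ∧ G = famU1 n i) ∨
  (∃ n i, 3 ≤ n ∧ 2 ≤ i ∧ 2 * i ≤ n + 1 ∧ G = famU0s n i) ∨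
  (∃ n x y, 4 ≤ n ∧ 2 ≤ x ∧ x < y ∧ y ≤ n - 1 ∧ x + y ≤ n + 1 ∧ G = famU0 n x y)

/-- The number of unit-clauses of `F`. -/
def unitCount (F : Finset (Finset Lit)) : ℕ := (F.filter (fun C => C.card = 1)).card

/-- MU 2-clause-sets of deficiency `k` with exactly `n` variables. -/
def MU2dn (k : ℤ) (n : ℕ) : Type :=
  {F : Finset (Finset Lit) // MU2 F ∧ deficiency F = k ∧ (varsOf F).card = n}

/-- Isomorphism relation on `MU2dn k n`. -/
def isoRel {k : ℤ} {n : ℕ} (F F' : MU2dn k n) : Prop := ∃ f, CNFIso F.1 F'.1 f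

/-- The number of isomorphism classes of MU 2-clause-sets of deficiency `k`
with exactly `n` variables. -/
noncomputable def numClasses (k : ℤ) (n : ℕ) : ℕ := Nat.card (Quot (@isoRel k n))

/-- Equivalence of binary bracelets of length `m`: rotations and reflections of the
cyclic index set. -/
def BraceletRel (m : ℕ) (b b' : ZMod m → Bool) : Prop :=
  ∃ (r : ZMod m) (s : Bool), ∀ i, b' i = b (if s then r - i else i + r)

/-- Digraph-isomorphism relation on nonlinear `m`-WDCs. -/
def NonlinWDCRel (m : ℕ) (G G' : {G : FinDigraph ℕ // IsWDC m G ∧ G.Nonlinear}) : Prop :=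
  ∃ f : ℕ → ℕ, DigraphIso G.1 G'.1 f

/-- `H` is a subdigraph of `G`. -/
def Subdigraph {α : Type} (H G : FinDigraph α) : Prop := H.V ⊆ G.V ∧ H.E ⊆ G.E

section SkewDigraph

open scoped Classical

variable {V : Type*} {A : V → V → Prop} {σ τ : V → V}

/-- A set of vertices containing exactly one vertex of each complementary pair. -/
def IsHalf (σ : V → V) (T : Finset V) : Prop := ∀ v, σ v ∈ T ↔ v ∉ T

/-- A half whose only outgoing arcs are `(a, b)` and its mirror image. -/
structure IsCut (A : V → V → Prop) (σ : V → V) (a b : V) (T : Finset V) : Prop where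
  half : IsHalf σ T
  tail : a ∈ T
  head : b ∉ T
  leave : ∀ p ∈ T, ∀ q, q ∉ T → A p q → (p = a ∧ q = b) ∨ (p = σ b ∧ q = σ a)

/-- A relation with a skew-symmetry, behaving like the implication digraph of a
minimally unsatisfiable 2-clause-set. -/
structure SkewMU (A : V → V → Prop) (σ : V → V) : Prop where
  inv : ∀ v, σ (σ v) = v
  ne : ∀ v, σ v ≠ v
  skew : ∀ a b, A a b → A (σ b) (σ a)
  unsat : ∀ T, IsHalf σ T → ∃ p ∈ T, ∃ q, q ∉ T ∧ A p q
  crit : ∀ a b, A a b → ∃ T, IsCut A σ a b T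
  inc : ∀ v, ∃ w, A v w ∨ A w v

namespace SkewMU

lemma irrefl (h : SkewMU A σ) (v : V) : ¬ A v v := fun hv => by
  obtain ⟨T, hT⟩ := h.crit _ _ hv
  exact hT.head hT.tail

lemma inj (h : SkewMU A σ) : Function.Injective σ := fun a b H => by
  rw [← h.inv a, H, h.inv]

variable [Fintype V]

/-- Strong connectivity: every nonempty proper set of vertices is entered by an arc. -/
lemma exists_entering (h : SkewMU A σ) (S : Finset V) {x y : V} (hx : x ∈ S) (hy : y ∉ S) :
    ∃ p, p ∉ S ∧ ∃ q ∈ S, A p q := by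
  by_contra! hS
  have hinv := h.inv
  have part : ∀ U : V → Prop, (∀ v, U (σ v) ↔ U v) → (∃ v, ¬ U v) →
      ∃ T, IsHalf σ T ∧ ∀ p ∈ T, ∀ q, q ∉ T → U p → U q → ¬ A p q := by
    rintro U hU ⟨v, hv⟩
    obtain ⟨a, b, hab, hUab⟩ : ∃ a b, A a b ∧ ¬ (U a ∧ U b) := by
      obtain ⟨w, hw | hw⟩ := h.inc v
      · exact ⟨v, w, hw, by tauto⟩
      · exact ⟨w, v, hw, by tauto⟩
    obtain ⟨T, hT⟩ := h.crit a b hab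
    refine ⟨T, hT.half, fun p hp q hq hUp hUq hpq => ?_⟩
    rcases hT.leave p hp q hq hpq with ⟨rfl, rfl⟩ | ⟨rfl, rfl⟩
    · exact hUab ⟨hUp, hUq⟩
    · exact hUab ⟨(hU a).1 hUq, (hU b).1 hUp⟩
  obtain ⟨T₁, hT₁, hc₁⟩ := part (fun v => v ∈ S ∧ σ v ∈ S) (by intro v; rw [hinv]; tauto)
    ⟨y, by tauto⟩
  obtain ⟨T₂, hT₂, hc₂⟩ := part (fun v => v ∉ S ∧ σ v ∉ S) (by intro v; rw [hinv]; tauto)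
    ⟨x, by tauto⟩
  have hO : ∀ p q, A p q → σ p ∈ S → σ q ∈ S := fun p q hpq hp => by
    by_contra hq
    exact hS _ hq _ hp (h.skew _ _ hpq)
  obtain ⟨p, hp, q, hq, hpq⟩ := h.unsat (Finset.univ.filter fun v =>
    (v ∈ S ∧ σ v ∈ S ∧ v ∈ T₁) ∨ (v ∉ S ∧ σ v ∈ S) ∨ (v ∉ S ∧ σ v ∉ S ∧ v ∈ T₂)) (by
      intro v
      have f₁ := hT₁ v
      have f₂ := hT₂ v
      simp only [Finset.mem_filter, Finset.mem_univ, true_and, hinv, f₁, f₂]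
      clear f₁ f₂ hO part hS hT₁ hT₂ hc₁ hc₂
      by_cases h₁ : v ∈ S <;> by_cases h₂ : σ v ∈ S <;> simp [h₁, h₂])
  simp only [Finset.mem_filter, Finset.mem_univ, true_and] at hp hq
  have h1 := hO p q hpq
  have h2 : p ∉ S → q ∉ S := fun a b => hS p a q b hpq
  have h3 : p ∈ T₁ → q ∉ T₁ → (p ∈ S ∧ σ p ∈ S) → ¬ (q ∈ S ∧ σ q ∈ S) :=
    fun a b c d => hc₁ p a q b c d hpq
  have h4 : p ∈ T₂ → q ∉ T₂ → (p ∉ S ∧ σ p ∉ S) → ¬ (q ∉ S ∧ σ q ∉ S) :=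
    fun a b c d => hc₂ p a q b c d hpq
  clear hO part hS hc₁ hc₂ hT₁ hT₂ hx hy
  by_cases g₁ : p ∈ S <;> by_cases g₂ : q ∈ S <;> by_cases g₃ : σ p ∈ S <;>
    by_cases g₄ : σ q ∈ S <;> simp_all

end SkewMU

/-- `D` contains no complementary pair, is entered only at `b`, and `b` lies in every cut
determined by an arc starting in `D`. -/
structure IsRooted (A : V → V → Prop) (σ : V → V) (D : Finset V) (b : V) : Prop where
  mem : b ∈ D
  disj : ∀ v ∈ D, σ v ∉ D
  enter : ∀ p, p ∉ D → ∀ q ∈ D, A p q → q = b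
  root : ∀ v ∈ D, ∀ c, A v c → ∀ T, IsCut A σ v c T → b ∈ T

namespace SkewMU

variable [Fintype V]

lemma isRooted (h : SkewMU A σ) {D : Finset V} {b : V} (hb : ¬ A (σ b) b) (mem : b ∈ D)
    (disj : ∀ v ∈ D, σ v ∉ D) (enter : ∀ p, p ∉ D → ∀ q ∈ D, A p q → q = b) :
    IsRooted A σ D b := by
  refine ⟨mem, disj, enter, fun v hv c hvc T hT => ?_⟩
  by_contra hbT
  have hinv := h.inv
  obtain ⟨p, hp, q, hq, hpq⟩ := h.unsat (Finset.univ.filter fun v =>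
    (v ∈ T ∧ v ∉ D) ∨ σ v ∈ D) (by
      intro u
      have := hT.half u
      have := disj u
      have := disj (σ u)
      simp only [Finset.mem_filter, Finset.mem_univ, true_and, hinv] at *
      tauto)
  simp only [Finset.mem_filter, Finset.mem_univ, true_and] at hp hq
  have hqp := h.skew _ _ hpq
  have e1 := fun a b => enter p a q b hpq
  have e2 := fun a b => enter (σ q) a (σ p) b hqp
  have e3 := fun a b => hT.leave p a q b hpq
  have e4 := hT.half b
  have e5 := hT.half p
  have e6 := hT.half q
  have e7 := h.inj.eq_iff (a := p) (b := b)
  have i1 := hinv p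
  have i2 := hinv q
  have i3 := hinv b
  have i4 := hinv v
  have d1 := disj p
  have d2 := disj q
  clear disj enter h hinv hvc
  grind

end SkewMU

namespace IsRooted

/-- The root has no predecessor inside the set. -/
lemma not_adj_root {D : Finset V} {b p : V} (hD : IsRooted A σ D b) (h : SkewMU A σ) (hp : p ∈ D) :
    ¬ A p b := fun hA => by
  obtain ⟨T, hT⟩ := h.crit _ _ hA
  exact hT.head (hD.root _ hp _ hA _ hT)

variable [Fintype V] {D : Finset V} {b : V}

/-- Every vertex of a rooted set has at most one predecessor inside the set. -/
lemma pred_unique (hD : IsRooted A σ D b) (h : SkewMU A σ) {p₁ p₂ y : V} (hy : y ∈ D)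
    (h₁ : p₁ ∈ D) (h₂ : p₂ ∈ D) (hA₁ : A p₁ y) (hA₂ : A p₂ y) : p₁ = p₂ := by
  obtain ⟨T₁, hT₁⟩ := h.crit _ _ hA₁
  obtain ⟨T₂, hT₂⟩ := h.crit _ _ hA₂
  have b₁ := hD.root _ h₁ _ hA₁ _ hT₁
  have b₂ := hD.root _ h₂ _ hA₂ _ hT₂
  obtain ⟨p, hp, q, hq, hpq⟩ := h.exists_entering
    (D.filter fun v => v ∉ T₁ ∨ v ∉ T₂) (x := y) (y := b)
    (by simp [hy, hT₁.head]) (by simp [b₁, b₂])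
  simp only [Finset.mem_filter] at hp hq
  have e1 := fun a b => hD.enter p a q b hpq
  have e2 := fun a b => hT₁.leave p a q b hpq
  have e3 := fun a b => hT₂.leave p a q b hpq
  have e4 := hD.disj y hy
  have e5 := hD.disj _ h₁
  have e6 := hD.disj _ h₂
  have t₁ := hT₁.head
  have t₂ := hT₂.head
  clear hT₁ hT₂ hD h
  grind

/-- A cut determined by an arc leaving a rooted set contains the whole set. -/
lemma subset_cut (hD : IsRooted A σ D b) (h : SkewMU A σ) {v c : V} (hv : v ∈ D) (hc : c ∉ D)
    (hA : A v c) {T : Finset V} (hT : IsCut A σ v c T) {u : V} (hu : u ∈ D) : u ∈ T := by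
  by_contra huT
  have hb := hD.root _ hv _ hA _ hT
  obtain ⟨p, hp, q, hq, hpq⟩ := h.exists_entering
    (D.filter fun v => v ∉ T) (x := u) (y := b) (by simp [hu, huT]) (by simp [hb])
  simp only [Finset.mem_filter] at hp hq
  have e1 := fun a b => hD.enter p a q b hpq
  have e2 := fun a b => hT.leave p a q b hpq
  have e4 := hD.disj v hv
  have e5 := hT.head
  have e6 := hT.half c
  have e7 := hD.disj q
  have e8 := hD.disj p
  have e9 := h.inv v
  clear hT hD h
  grind

/-- If an arc joins a rooted set with its mirror image, then every arc leaving the set is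
this arc or its mirror image. -/
lemma leave_mirror (hD : IsRooted A σ D b) (h : SkewMU A σ) {v₁ c₁ v₂ c₂ : V}
    (hv₁ : v₁ ∈ D) (hc₁ : σ c₁ ∈ D) (hA₁ : A v₁ c₁) (hv₂ : v₂ ∈ D) (hc₂ : c₂ ∉ D)
    (hA₂ : A v₂ c₂) : (v₁ = v₂ ∧ c₁ = c₂) ∨ (v₁ = σ c₂ ∧ c₁ = σ v₂) := by
  obtain ⟨T, hT⟩ := h.crit _ _ hA₂
  have := fun u => hD.subset_cut h hv₂ hc₂ hA₂ hT (u := u)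
  exact hT.leave _ (this _ hv₁) _ ((hT.half c₁).1 (this _ hc₁)) hA₁

/-- At most two arcs leave a rooted set. -/
lemma leave_le_two (hD : IsRooted A σ D b) (h : SkewMU A σ) {v₁ c₁ v₂ c₂ v₃ c₃ : V}
    (hv₁ : v₁ ∈ D) (hc₁ : c₁ ∉ D) (hA₁ : A v₁ c₁) (hv₂ : v₂ ∈ D) (hc₂ : c₂ ∉ D)
    (hA₂ : A v₂ c₂) (hv₃ : v₃ ∈ D) (hc₃ : c₃ ∉ D) (hA₃ : A v₃ c₃)
    (n₁₂ : ¬ (v₁ = v₂ ∧ c₁ = c₂)) (n₁₃ : ¬ (v₁ = v₃ ∧ c₁ = c₃))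
    (n₂₃ : ¬ (v₂ = v₃ ∧ c₂ = c₃)) : False := by
  have hinv := h.inv
  by_cases m₁ : σ c₁ ∈ D
  · have := hD.leave_mirror h hv₁ m₁ hA₁ hv₂ hc₂ hA₂
    have := hD.leave_mirror h hv₁ m₁ hA₁ hv₃ hc₃ hA₃
    grind
  by_cases m₂ : σ c₂ ∈ D
  · have := hD.leave_mirror h hv₂ m₂ hA₂ hv₁ hc₁ hA₁
    have := hD.leave_mirror h hv₂ m₂ hA₂ hv₃ hc₃ hA₃
    grind
  by_cases m₃ : σ c₃ ∈ D
  · have := hD.leave_mirror h hv₃ m₃ hA₃ hv₁ hc₁ hA₁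
    have := hD.leave_mirror h hv₃ m₃ hA₃ hv₂ hc₂ hA₂
    grind
  obtain ⟨T₁, hT₁⟩ := h.crit _ _ hA₁
  obtain ⟨T₂, hT₂⟩ := h.crit _ _ hA₂
  obtain ⟨T₃, hT₃⟩ := h.crit _ _ hA₃
  have s₁ := fun u => hD.subset_cut h hv₁ hc₁ hA₁ hT₁ (u := u)
  have s₂ := fun u => hD.subset_cut h hv₂ hc₂ hA₂ hT₂ (u := u)
  have s₃ := fun u => hD.subset_cut h hv₃ hc₃ hA₃ hT₃ (u := u)
  have key : ∀ {v c v' c' : V} {T : Finset V}, v ∈ D → A v c → v' ∈ D → σ c ∉ D →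
      (∀ u ∈ D, u ∈ T) → IsCut A σ v' c' T → ¬ (v = v' ∧ c = c') → c ∈ T := by
    intro v c v' c' T hv hA hv' hm hs hT hn
    by_contra hc
    rcases hT.leave v (hs v hv) c hc hA with H | ⟨_, rfl⟩
    · exact hn H
    · exact hm (by rwa [hinv])
  have swap : ∀ {a b c d : V}, a = b ∧ c = d → b = a ∧ d = c := fun H => ⟨H.1.symm, H.2.symm⟩
  have c₁₂ := key hv₁ hA₁ hv₂ m₁ s₂ hT₂ n₁₂
  have c₁₃ := key hv₁ hA₁ hv₃ m₁ s₃ hT₃ n₁₃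
  have c₂₁ := key hv₂ hA₂ hv₁ m₂ s₁ hT₁ (n₁₂ ∘ swap)
  have c₂₃ := key hv₂ hA₂ hv₃ m₂ s₃ hT₃ n₂₃
  have c₃₁ := key hv₃ hA₃ hv₁ m₃ s₁ hT₁ (n₁₃ ∘ swap)
  have c₃₂ := key hv₃ hA₃ hv₂ m₃ s₂ hT₂ (n₂₃ ∘ swap)
  have i₁ := hT₁.half
  have i₂ := hT₂.half
  have i₃ := hT₃.half
  have out : ∀ p q, A p q → p ∈ T₁ → p ∈ T₂ → q ∉ T₁ ∨ q ∉ T₂ →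
      (p = v₁ ∧ q = c₁) ∨ (p = v₂ ∧ q = c₂) := by
    intro p q hpq hp₁ hp₂ hq
    by_cases hq₁ : q ∈ T₁
    · rcases hT₂.leave p hp₂ q (hq.resolve_left (not_not.2 hq₁)) hpq with H | ⟨rfl, _⟩
      · exact .inr H
      · exact absurd c₂₁ ((i₁ c₂).1 hp₁)
    · rcases hT₁.leave p hp₁ q hq₁ hpq with H | ⟨rfl, _⟩
      · exact .inl H
      · exact absurd c₁₂ ((i₂ c₁).1 hp₂)
  obtain ⟨p, hp, q, hq, hpq⟩ := h.unsat (Finset.univ.filter fun v =>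
    (v ∈ T₃ ∧ ¬ (σ v ∈ T₁ ∧ σ v ∈ T₂)) ∨ (v ∈ T₁ ∧ v ∈ T₂)) (by
      intro u
      simp only [Finset.mem_filter, Finset.mem_univ, true_and, hinv, i₁ u, i₂ u, i₃ u]
      by_cases g₁ : u ∈ T₁ <;> by_cases g₂ : u ∈ T₂ <;> by_cases g₃ : u ∈ T₃ <;>
        simp [g₁, g₂, g₃])
  simp only [Finset.mem_filter, Finset.mem_univ, true_and, not_or] at hp hq
  have new : ∀ p' q', A p' q' → p' ∈ T₁ ∧ p' ∈ T₂ → ¬ (q' ∈ T₁ ∧ q' ∈ T₂) →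
      q' ∈ T₃ ∧ ¬ (σ q' ∈ T₁ ∧ σ q' ∈ T₂) := by
    intro p' q' hA hp' hq'
    rcases out p' q' hA hp'.1 hp'.2 (by by_contra! H; exact hq' H) with ⟨_, rfl⟩ | ⟨_, rfl⟩
    · exact ⟨c₁₃, fun H => (i₂ _).1 H.2 c₁₂⟩
    · exact ⟨c₂₃, fun H => (i₁ _).1 H.1 c₂₁⟩
  by_cases hp' : p ∈ T₁ ∧ p ∈ T₂
  · exact hq.1 (new p q hpq hp' hq.2)
  obtain ⟨hp₃, hσp⟩ := hp.resolve_right hp'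
  by_cases hσq : σ q ∈ T₁ ∧ σ q ∈ T₂
  · exact (i₃ p).1 (new _ _ (h.skew p q hpq) hσq hσp).1 hp₃
  rcases hT₃.leave p hp₃ q (fun H => hq.1 ⟨H, hσq⟩) hpq with ⟨rfl, _⟩ | ⟨rfl, _⟩
  · exact hp' ⟨s₁ _ hv₃, s₂ _ hv₃⟩
  · rw [hinv] at hσp
    exact hσp ⟨c₃₁, c₃₂⟩

end IsRooted

/-- In-degree. -/
noncomputable def inD [Fintype V] (A : V → V → Prop) (v : V) : ℕ :=
  (Finset.univ.filter fun u => A u v).card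

/-- Out-degree. -/
noncomputable def outD [Fintype V] (A : V → V → Prop) (v : V) : ℕ :=
  (Finset.univ.filter fun u => A v u).card

/-- The number of arcs entering a set of vertices. -/
noncomputable def enterD [Fintype V] (A : V → V → Prop) (S : Finset V) : ℕ :=
  (Finset.univ.filter fun e : V × V => e.1 ∉ S ∧ e.2 ∈ S ∧ A e.1 e.2).card

/-- The number of arcs leaving a set of vertices. -/
noncomputable def leaveD [Fintype V] (A : V → V → Prop) (S : Finset V) : ℕ :=
  (Finset.univ.filter fun e : V × V => e.1 ∈ S ∧ e.2 ∉ S ∧ A e.1 e.2).card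

section Counting

variable [Fintype V]

lemma sum_inD (S : Finset V) : ∑ v ∈ S, inD A v =
    (Finset.univ.filter fun e : V × V => e.2 ∈ S ∧ A e.1 e.2).card := by
  simp only [inD, Finset.card_filter, Fintype.sum_prod_type, ite_and]
  rw [Finset.sum_comm]
  refine Finset.sum_congr rfl fun u _ => ?_
  rw [Finset.sum_ite_mem, Finset.univ_inter]

lemma sum_outD (S : Finset V) : ∑ v ∈ S, outD A v =
    (Finset.univ.filter fun e : V × V => e.1 ∈ S ∧ A e.1 e.2).card := by
  simp only [outD, Finset.card_filter, Fintype.sum_prod_type_right, ite_and]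
  rw [Finset.sum_comm]
  refine Finset.sum_congr rfl fun u _ => ?_
  rw [Finset.sum_ite_mem, Finset.univ_inter]

lemma degree_balance (S : Finset V) :
    ∑ v ∈ S, inD A v + leaveD A S = ∑ v ∈ S, outD A v + enterD A S := by
  rw [sum_inD, sum_outD, leaveD, enterD]
  simp only [Finset.card_filter, ← Finset.sum_add_distrib]
  refine Finset.sum_congr rfl fun e _ => ?_
  by_cases h₁ : e.1 ∈ S <;> by_cases h₂ : e.2 ∈ S <;> simp [h₁, h₂]

lemma sum_inD_univ : ∑ v, inD A v = ∑ v, outD A v := by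
  rw [sum_inD, sum_outD]; simp

lemma inD_le_one {v : V} (hv : ∀ p q, A p v → A q v → p = q) : inD A v ≤ 1 := by
  refine Finset.card_le_one.2 fun p hp q hq => hv p q ?_ ?_ <;> simp_all

lemma enterD_pos {S : Finset V} {p q : V} (hp : p ∉ S) (hq : q ∈ S) (hA : A p q) :
    1 ≤ enterD A S :=
  Finset.card_pos.2 ⟨(p, q), by simp [*]⟩

/-- Weights of the two sides of a half agree for weights invariant under the symmetry. -/
lemma IsHalf.sum_eq (hσ : Function.Involutive σ) {T : Finset V} (hT : IsHalf σ T) {ω : V → ℕ}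
    (hω : ∀ v, ω (σ v) = ω v) : ∑ v ∈ T, ω v = ∑ v ∈ Tᶜ, ω v := by
  refine Finset.sum_bij' (fun v _ => σ v) (fun v _ => σ v) ?_ ?_ ?_ ?_ ?_
  · intro v hv; simpa [hT v] using hv
  · intro v hv; simpa [hT v] using hv
  · intro v _; exact hσ v
  · intro v _; exact hσ v
  · intro v _; exact (hω v).symm

end Counting

namespace SkewMU

variable [Fintype V]

lemma outD_map (h : SkewMU A σ) (v : V) : outD A (σ v) = inD A v := by
  refine Finset.card_bij' (fun u _ => σ u) (fun u _ => σ u) ?_ ?_ ?_ ?_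
  · intro u hu
    simpa [h.inv] using h.skew _ _ (Finset.mem_filter.1 hu).2
  · intro u hu
    simpa using h.skew _ _ (Finset.mem_filter.1 hu).2
  · intro u _; exact h.inv u
  · intro u _; exact h.inv u

lemma inD_map (h : SkewMU A σ) (v : V) : inD A (σ v) = outD A v := by
  rw [← h.outD_map, h.inv]

lemma deg_map (h : SkewMU A σ) (v : V) :
    inD A (σ v) + outD A (σ v) = inD A v + outD A v := by
  rw [h.outD_map, h.inD_map, add_comm]

lemma one_le_inD (h : SkewMU A σ) (v : V) : 1 ≤ inD A v := by
  obtain ⟨p, _, q, hq, hpq⟩ := h.exists_entering {v} (x := v) (y := σ v) (by simp)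
    (by simpa using h.ne v)
  obtain rfl := Finset.mem_singleton.1 hq
  exact Finset.card_pos.2 ⟨p, by simpa using hpq⟩

lemma one_le_outD (h : SkewMU A σ) (v : V) : 1 ≤ outD A v := by
  rw [← h.inD_map]; exact h.one_le_inD _

end SkewMU

namespace IsRooted

variable [Fintype V] {D : Finset V} {b : V}

lemma leaveD_le_two (hD : IsRooted A σ D b) (h : SkewMU A σ) : leaveD A D ≤ 2 := by
  by_contra! H
  obtain ⟨⟨v₁, c₁⟩, m₁, ⟨v₂, c₂⟩, m₂, ⟨v₃, c₃⟩, m₃, n₁₂, n₁₃, n₂₃⟩ := Finset.two_lt_card.1 H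
  simp only [Finset.mem_filter, Finset.mem_univ, true_and, ne_eq, Prod.mk.injEq] at *
  exact hD.leave_le_two h m₁.1 m₁.2.1 m₁.2.2 m₂.1 m₂.2.1 m₂.2.2 m₃.1 m₃.2.1 m₃.2.2 n₁₂ n₁₃ n₂₃

end IsRooted

namespace SkewMU

variable [Fintype V]

/-- Arcs and units are numerous, as is the case for deficiency at least two. -/
def Dense (A : V → V → Prop) (σ : V → V) : Prop :=
  Fintype.card V + 4 ≤ ∑ v, inD A v + (Finset.univ.filter fun v => A (σ v) v).card

lemma not_unit (h : SkewMU A σ) (hd : Dense A σ) (x : V) : ¬ A (σ x) x := fun hx => by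
  have hinv := h.inv
  obtain ⟨T, hT⟩ := h.crit _ _ hx
  have leave : ∀ p ∈ T, ∀ q, q ∉ T → A p q → p = σ x ∧ q = x := fun p hp q hq hpq => by
    simpa [hinv] using hT.leave p hp q hq hpq
  have hR : IsRooted A σ Tᶜ x := by
    refine ⟨by simpa using hT.head, fun v hv => ?_, fun p hp q hq hpq => ?_,
      fun v hv c hvc T' hT' => ?_⟩
    · simpa [hT.half v] using hv
    · exact (leave p (by simpa using hp) q (by simpa using hq) hpq).2
    · by_contra hxT
      have hv' : v = σ x := by
        rcases hT'.leave _ ((hT'.half x).2 hxT) x hxT hx with ⟨H, _⟩ | ⟨_, H⟩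
        · exact H.symm
        · rw [H, hinv]
      exact Finset.mem_compl.1 hv (hv' ▸ hT.tail)
  have hind : ∀ y ∈ Tᶜ, inD A y ≤ 1 := by
    refine fun y hy => inD_le_one fun p q hp hq => ?_
    have root : ∀ p, A p x → p = σ x := fun p hp => by
      by_cases hpT : p ∈ T
      · exact (leave p hpT x hT.head hp).1
      · exact absurd hp (hR.not_adj_root h (by simpa using hpT))
    by_cases hyx : y = x
    · subst hyx
      rw [root p hp, root q hq]
    · have inT : ∀ p, A p y → p ∈ Tᶜ := fun p hp => by
        by_contra H
        exact hyx (hR.enter p H y hy hp)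
      exact hR.pred_unique h hy (inT p hp) (inT q hq) hp hq
  have h1 : ∑ v ∈ Tᶜ, inD A v ≤ (Tᶜ).card := by simpa using Finset.sum_le_card_nsmul _ _ 1 hind
  have h2 := hR.leaveD_le_two h
  have h3 : 1 ≤ enterD A Tᶜ := enterD_pos (by simpa using hT.tail) (by simpa using hT.head) hx
  have h4 := degree_balance (A := A) Tᶜ
  have h5 : ∑ v ∈ T, (inD A v + outD A v) = _ := hT.half.sum_eq hinv h.deg_map
  have h6 : ∑ v ∈ T, 1 = _ := hT.half.sum_eq hinv (fun _ => rfl)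
  simp only [Finset.sum_add_distrib] at h5
  have h7 := Finset.sum_add_sum_compl T (inD A)
  have h8 := Finset.sum_add_sum_compl T (outD A)
  have h9 := sum_inD_univ (A := A)
  have h10 := Finset.card_add_card_compl T
  simp only [Finset.sum_const, smul_eq_mul, mul_one] at h6
  have h11 : (Finset.univ.filter fun v => A (σ v) v).card ≤ 2 := by
    have hsub : (Finset.univ.filter fun v => A (σ v) v) ⊆
        {x} ∪ T.filter fun v => A (σ v) v := by
      intro v hv
      simp only [Finset.mem_filter, Finset.mem_univ, true_and, Finset.mem_union,
        Finset.mem_singleton] at hv ⊢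
      by_cases hvT : v ∈ T
      · exact .inr ⟨hvT, hv⟩
      · exact .inl (leave _ ((hT.half v).2 hvT) v hvT hv).2
    have hone : (T.filter fun v => A (σ v) v).card ≤ 1 := by
      refine Finset.card_le_one.2 fun v hv w hw => ?_
      simp only [Finset.mem_filter] at hv hw
      have e : ∀ v ∈ T, σ v ∈ Tᶜ ∧ v ∉ Tᶜ := fun v hv => by simp [hT.half v, hv]
      rcases hR.leave_mirror h (e v hv.1).1 (e v hv.1).1 hv.2 (e w hw.1).1 (e w hw.1).2 hw.2
        with H | H
      · exact H.2
      · exact h.inj H.1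
    calc _ ≤ _ := Finset.card_le_card hsub
      _ ≤ _ := Finset.card_union_le _ _
      _ ≤ 2 := by rw [Finset.card_singleton]; omega
  unfold Dense at hd
  omega

/-- A set without complementary pairs entered by a single arc has a root of in-degree one. -/
lemma exit_cut (h : SkewMU A σ) {Y : Finset V} {a b y p : V} (hb : ¬ A (σ b) b)
    (disj : ∀ v ∈ Y, σ v ∉ Y) (hy : y ∈ Y)
    (enter : ∀ p, p ∉ Y → ∀ q ∈ Y, A p q → p = a ∧ q = b) (hp : A p b) : p = a := by
  obtain ⟨p', hp', q, hq, hpq⟩ := h.exists_entering Y hy (disj y hy)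
  obtain ⟨rfl, rfl⟩ := enter p' hp' q hq hpq
  have hR := h.isRooted hb hq disj (fun p hp q hq hpq => (enter p hp q hq hpq).2)
  by_contra hne
  have hpY : p ∈ Y := by
    by_contra H
    exact hne (enter p H _ hq hp).1
  exact hR.not_adj_root h hpY hp

end SkewMU

/-- A rooted set entered by exactly two arcs has small degree sum. -/
lemma IsRooted.sum_deg_le [Fintype V] {D : Finset V} {b a₁ a₂ : V} (hD : IsRooted A σ D b)
    (h : SkewMU A σ) (hne : a₁ ≠ a₂) (h₁ : a₁ ∉ D) (h₂ : a₂ ∉ D) (hA₁ : A a₁ b) (hA₂ : A a₂ b)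
    (enter : ∀ p, p ∉ D → A p b → p = a₁ ∨ p = a₂) :
    ∑ v ∈ D, (inD A v + outD A v) ≤ 2 * D.card + 2 := by
  have hind : ∀ y ∈ D.erase b, inD A y ≤ 1 := by
    refine fun y hy => inD_le_one fun p q hp hq => ?_
    obtain ⟨hyb, hy⟩ := Finset.mem_erase.1 hy
    have mem : ∀ p, A p y → p ∈ D := fun p hp => by
      by_contra H
      exact hyb (hD.enter p H y hy hp)
    exact hD.pred_unique h hy (mem p hp) (mem q hq) hp hq
  have hb : inD A b ≤ 2 := by
    refine (Finset.card_le_card (t := {a₁, a₂}) fun p hp => ?_).trans Finset.card_le_two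
    have hpb := (Finset.mem_filter.1 hp).2
    simpa using enter p (fun hpD => hD.not_adj_root h hpD hpb) hpb
  have h1 : ∑ v ∈ D.erase b, inD A v ≤ (D.erase b).card := by
    simpa using Finset.sum_le_card_nsmul _ _ 1 hind
  have h2 := Finset.add_sum_erase D (inD A) hD.mem
  have h3 := Finset.card_erase_add_one hD.mem
  have h4 := hD.leaveD_le_two h
  have h5 : 2 ≤ enterD A D := by
    refine Finset.one_lt_card.2 ⟨(a₁, b), ?_, (a₂, b), ?_, by simpa using hne⟩ <;>
      simp [*, hD.mem]
  have h6 := degree_balance (A := A) D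
  rw [Finset.sum_add_distrib]
  omega

lemma IsHalf.sum_inter_eq [Fintype V] (hσ : Function.Involutive σ) (hτ : Function.Involutive τ)
    {T₁ T₂ : Finset V} (hT₁ : IsHalf σ T₁) (hT₂ : IsHalf τ T₂) {ω : V → ℕ}
    (h₁ : ∀ v, ω (σ v) = ω v) (h₂ : ∀ v, ω (τ v) = ω v) :
    ∑ v ∈ T₁ ∩ T₂, ω v = ∑ v ∈ (T₁ ∪ T₂)ᶜ, ω v := by
  have e₁ := hT₁.sum_eq hσ h₁
  have e₂ := hT₂.sum_eq hτ h₂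
  have key : 2 * ∑ v ∈ T₁ ∩ T₂, ω v + (∑ v ∈ T₁ᶜ, ω v + ∑ v ∈ T₂ᶜ, ω v) =
      2 * ∑ v ∈ (T₁ ∪ T₂)ᶜ, ω v + (∑ v ∈ T₁, ω v + ∑ v ∈ T₂, ω v) := by
    have ite : ∀ S : Finset V, ∑ v ∈ S, ω v = ∑ v, if v ∈ S then ω v else 0 := fun S => by
      rw [Finset.sum_ite_mem, Finset.univ_inter]
    simp only [ite, Finset.mul_sum, ← Finset.sum_add_distrib]
    refine Finset.sum_congr rfl fun v _ => ?_
    by_cases m₁ : v ∈ T₁ <;> by_cases m₂ : v ∈ T₂ <;> simp [m₁, m₂] <;> ring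
  omega

namespace SkewMU

variable [Fintype V]

/-- The mirror image of `exit_cut`. -/
lemma exit_cut_mirror (h : SkewMU A σ) {X : Finset V} {a b x p : V} (hb : ¬ A (σ b) b)
    (disj : ∀ v ∈ X, σ v ∉ X) (hx : x ∈ X)
    (leave : ∀ p ∈ X, ∀ q, q ∉ X → A p q → p = σ b ∧ q = σ a) (hp : A p b) : p = a := by
  refine h.exit_cut (Y := Finset.univ.filter fun v => σ v ∈ X) (y := σ x) hb ?_ ?_ ?_ hp
  · intro v hv
    simpa using disj _ (by simpa using hv)
  · simpa [h.inv] using hx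
  · intro p hp q hq hpq
    simp only [Finset.mem_filter, Finset.mem_univ, true_and] at hp hq
    have H := leave _ hq _ hp (h.skew _ _ hpq)
    exact ⟨h.inj H.2, h.inj H.1⟩

/-- Any two skew-symmetries agree at vertices of in-degree at least two. -/
lemma eq_of_two_in (hσ : SkewMU A σ) (hτ : SkewMU A τ) (uσ : ∀ x, ¬ A (σ x) x)
    (uτ : ∀ x, ¬ A (τ x) x) {a₁ a₂ b : V} (hne : a₁ ≠ a₂) (hA₁ : A a₁ b) (hA₂ : A a₂ b) :
    σ b = τ b := by
  by_contra hστ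
  obtain ⟨T₁, hT₁⟩ := hσ.crit _ _ hA₁
  obtain ⟨T₂, hT₂⟩ := hτ.crit _ _ hA₂
  have n₂ : a₂ ∉ T₁ := fun H => by
    rcases hT₁.leave _ H b hT₁.head hA₂ with ⟨H, _⟩ | ⟨rfl, _⟩
    exacts [hne H.symm, uσ b hA₂]
  have n₁ : a₁ ∉ T₂ := fun H => by
    rcases hT₂.leave _ H b hT₂.head hA₁ with ⟨H, _⟩ | ⟨rfl, _⟩
    exacts [hne H, uτ b hA₁]
  have leave : ∀ p ∈ T₁ ∩ T₂, ∀ q, q ∉ T₁ ∩ T₂ → A p q →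
      (p = σ b ∧ q = σ a₁) ∨ (p = τ b ∧ q = τ a₂) := by
    intro p hp q hq hpq
    obtain ⟨hp₁, hp₂⟩ := Finset.mem_inter.1 hp
    by_cases hq₁ : q ∈ T₁
    · have hq₂ : q ∉ T₂ := fun H => hq (Finset.mem_inter.2 ⟨hq₁, H⟩)
      rcases hT₂.leave p hp₂ q hq₂ hpq with ⟨rfl, _⟩ | H
      exacts [absurd hp₁ n₂, .inr H]
    · rcases hT₁.leave p hp₁ q hq₁ hpq with ⟨rfl, _⟩ | H
      exacts [absurd hp₂ n₁, .inl H]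
  have hbD : b ∈ (T₁ ∪ T₂)ᶜ := by simp [hT₁.head, hT₂.head]
  have hcard : ∑ v ∈ T₁ ∩ T₂, 1 = ∑ v ∈ (T₁ ∪ T₂)ᶜ, 1 :=
    hT₁.half.sum_inter_eq hσ.inv hτ.inv hT₂.half (fun _ => rfl) (fun _ => rfl)
  have hdeg : ∑ v ∈ T₁ ∩ T₂, (inD A v + outD A v) = _ :=
    hT₁.half.sum_inter_eq hσ.inv hτ.inv hT₂.half hσ.deg_map hτ.deg_map
  simp only [Finset.sum_const, smul_eq_mul, mul_one] at hcard
  obtain ⟨x, hx⟩ : (T₁ ∩ T₂).Nonempty := by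
    rw [← Finset.card_pos, hcard]
    exact Finset.card_pos.2 ⟨b, hbD⟩
  have mτ : τ b ∈ T₁ ∩ T₂ := by
    by_contra hmem
    refine hne (hσ.exit_cut_mirror (uσ b) (fun v hv => ?_) hx (fun p hp q hq hpq => ?_) hA₂).symm
    · simp [hT₁.half v, (Finset.mem_inter.1 hv).1]
    · exact (leave p hp q hq hpq).resolve_right fun H => hmem (H.1 ▸ hp)
  have mσ : σ b ∈ T₁ ∩ T₂ := by
    by_contra hmem
    refine hne (hτ.exit_cut_mirror (uτ b) (fun v hv => ?_) hx (fun p hp q hq hpq => ?_) hA₁)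
    · simp [hT₂.half v, (Finset.mem_inter.1 hv).2]
    · exact (leave p hp q hq hpq).resolve_left fun H => hmem (H.1 ▸ hp)
  rw [Finset.mem_inter] at mτ mσ
  have enter : ∀ p, p ∉ (T₁ ∪ T₂)ᶜ → ∀ q ∈ (T₁ ∪ T₂)ᶜ, A p q → q = b ∧ (p = a₁ ∨ p = a₂) := by
    intro p hp q hq hpq
    simp only [Finset.mem_compl, Finset.mem_union, not_or, not_not, not_and_or] at hp hq
    have f₁ := fun hp => hT₁.leave p hp q hq.1 hpq
    have f₂ := fun hp => hT₂.leave p hp q hq.2 hpq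
    rcases hp with hp | hp
    · rcases f₁ hp with H | ⟨rfl, _⟩
      · exact ⟨H.2, .inl H.1⟩
      · rcases f₂ mσ.2 with H | H
        exacts [⟨H.2, .inr H.1⟩, absurd H.1 hστ]
    · rcases f₂ hp with H | ⟨rfl, _⟩
      · exact ⟨H.2, .inr H.1⟩
      · rcases f₁ mτ.1 with H | H
        exacts [⟨H.2, .inl H.1⟩, absurd H.1.symm hστ]
  have hR : IsRooted A σ (T₁ ∪ T₂)ᶜ b := by
    refine hσ.isRooted (uσ b) hbD (fun v hv => ?_) (fun p hp q hq hpq => (enter p hp q hq hpq).1)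
    have : v ∉ T₁ := fun H => Finset.mem_compl.1 hv (Finset.mem_union_left _ H)
    simp [hT₁.half v, this]
  have hD := hR.sum_deg_le hσ hne (by simp [hT₁.tail]) (by simp [hT₂.tail]) hA₁ hA₂
    (fun p hp hpb => (enter p hp b hbD hpb).2)
  have hin : 2 ≤ inD A b := Finset.one_lt_card.2 ⟨a₁, by simpa, a₂, by simpa, hne⟩
  have hout : (T₁ ∩ T₂).card + 2 ≤ ∑ v ∈ T₁ ∩ T₂, outD A v := by
    have hle : ∑ v ∈ T₁ ∩ T₂, (1 + ((if v = σ b then 1 else 0) + if v = τ b then 1 else 0)) ≤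
        ∑ v ∈ T₁ ∩ T₂, outD A v := by
      refine Finset.sum_le_sum fun v _ => ?_
      split_ifs with e₁ e₂ e₂
      · exact absurd (e₁.symm.trans e₂) hστ
      · rw [e₁, hσ.outD_map]; exact hin
      · rw [e₂, hτ.outD_map]; exact hin
      · exact hσ.one_le_outD v
    simpa [Finset.sum_add_distrib, Finset.sum_ite_eq', mσ, mτ] using hle
  have hl : leaveD A (T₁ ∩ T₂) ≤ 2 := by
    refine (Finset.card_le_card (t := {(σ b, σ a₁), (τ b, τ a₂)}) fun e he => ?_).trans
      Finset.card_le_two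
    obtain ⟨h₁, h₂, h₃⟩ := (Finset.mem_filter.1 he).2
    simpa [Prod.ext_iff] using leave _ h₁ _ h₂ h₃
  obtain ⟨p, hp, q, hq, hpq⟩ := hσ.exists_entering (T₁ ∩ T₂) (y := b) hx (by simp [hT₁.head])
  have he := enterD_pos hp hq hpq
  have hbal := degree_balance (A := A) (T₁ ∩ T₂)
  rw [Finset.sum_add_distrib] at hdeg
  omega

/-- Without units, no vertex has three predecessors. -/
lemma not_three_in (h : SkewMU A σ) (hu : ∀ x, ¬ A (σ x) x) {a₁ a₂ a₃ b : V} (h₁ : A a₁ b)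
    (h₂ : A a₂ b) (h₃ : A a₃ b) (n₁₂ : a₁ ≠ a₂) (n₁₃ : a₁ ≠ a₃) (n₂₃ : a₂ ≠ a₃) : False := by
  have hR : IsRooted A σ {σ b} (σ b) := by
    refine h.isRooted (hu _) (by simp) (fun v hv => ?_) (fun p _ q hq _ => by simpa using hq)
    obtain rfl := Finset.mem_singleton.1 hv
    simpa using h.ne _
  have out : ∀ a, A a b → σ a ∉ ({σ b} : Finset V) := fun a ha hab => by
    rw [Finset.mem_singleton, h.inj.eq_iff] at hab
    exact h.irrefl b (hab ▸ ha)
  have n : ∀ {a a' : V}, a ≠ a' → ¬ (σ b = σ b ∧ σ a = σ a') := fun hne H => hne (h.inj H.2)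
  have m : σ b ∈ ({σ b} : Finset V) := by simp
  exact hR.leave_le_two h m (out _ h₁) (h.skew _ _ h₁) m (out _ h₂) (h.skew _ _ h₂) m
    (out _ h₃) (h.skew _ _ h₃) (n n₁₂) (n n₁₃) (n n₂₃)

end SkewMU

namespace SkewMU

variable [Fintype V]

/-- The skew-symmetry is determined by the arcs. -/
theorem symm_unique (hσ : SkewMU A σ) (hτ : SkewMU A τ) (dσ : Dense A σ) (dτ : Dense A τ)
    (v : V) : σ v = τ v := by
  have uσ := hσ.not_unit dσ
  have uτ := hτ.not_unit dτ
  have two_in : ∀ {x y u : V}, A x u → A y u → σ u ≠ τ u → x = y := fun hx hy hu => by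
    by_contra hne
    exact hu (hσ.eq_of_two_in hτ uσ uτ hne hx hy)
  have mσ : ∀ x, σ x ≠ τ x → σ (σ x) ≠ τ (σ x) := fun x hx H => hx <| by
    rw [hσ.inv] at H
    conv_rhs => rw [H, hτ.inv]
  have hin : ∀ x, σ x ≠ τ x → inD A x = 1 := fun x hx =>
    le_antisymm (inD_le_one fun p q hp hq => two_in hp hq hx) (hσ.one_le_inD x)
  have hout : ∀ x, σ x ≠ τ x → outD A x = 1 := fun x hx => by
    rw [← hσ.inD_map, hin _ (mσ x hx)]
  have dense : Fintype.card V + 4 ≤ ∑ v, inD A v := by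
    have := dσ
    rw [Dense, Finset.filter_false_of_mem (fun x _ => uσ x)] at this
    simpa using this
  obtain ⟨y, hy⟩ : ∃ y, σ y = τ y := by
    by_contra! H
    simp only [hin _ (H _), Finset.sum_const, Finset.card_univ, smul_eq_mul] at dense
    omega
  by_contra hv
  -- the automorphism `τ ∘ σ`
  set π : V → V := fun x => τ (σ x) with hπ
  have πA : ∀ {p q : V}, A p q → A (π p) (π q) := fun hpq => hτ.skew _ _ (hσ.skew _ _ hpq)
  have πinj : Function.Injective π := hτ.inj.comp hσ.inj
  have πfix : ∀ x, π x = x ↔ σ x = τ x := fun x =>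
    ⟨fun H => by rw [← hτ.inv (σ x)]; exact congrArg τ H, fun H => by simp [hπ, H, hτ.inv]⟩
  have πinv : ∀ x, π (π x) = x := by
    by_contra! H
    obtain ⟨z, hz⟩ := H
    obtain ⟨x, hx, u, hu, hxu⟩ := hσ.exists_entering (Finset.univ.filter fun x => π (π x) = x)
      (x := y) (y := z) (by simp [(πfix y).2 hy]) (by simpa using hz)
    simp only [Finset.mem_filter, Finset.mem_univ, true_and] at hx hu
    have hxu₁ := πA hxu
    have hxu₂ := πA hxu₁
    by_cases hfix : π u = u
    · have hne : x ≠ π x := fun H => hx (by rw [← H, ← H])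
      rw [hfix] at hxu₁ hxu₂
      rw [hfix] at hxu₂
      exact hσ.not_three_in uσ hxu hxu₁ hxu₂ hne (Ne.symm hx) (πinj.ne hne)
    · rw [hu] at hxu₂
      exact hx (two_in hxu₂ hxu (mt (πfix u).2 hfix))
  have comm : ∀ v, σ (π v) = π (σ v) := fun v => by
    have := πinv v
    simp only [hπ, hσ.inv] at this ⊢
    rw [← hτ.inv (σ (τ (σ v))), this]
  obtain ⟨x, hx, u, hu, hxu⟩ := hσ.exists_entering (Finset.univ.filter fun x => σ x = τ x)
    (x := y) (y := v) (by simpa using hy) (by simpa using hv)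
  simp only [Finset.mem_filter, Finset.mem_univ, true_and] at hx hu
  have πu := (πfix u).2 hu
  have πx : π x ≠ x := mt (πfix x).1 hx
  have hπxu : A (π x) u := πu ▸ πA hxu
  obtain ⟨T, hT⟩ := hσ.crit _ _ hxu
  have hπxT : π x ∉ T := fun H => by
    rcases hT.leave _ H u hT.head hπxu with ⟨H, _⟩ | ⟨H, _⟩
    · exact πx H
    · refine πx (πinj ?_)
      rw [H, ← comm, πu]
  set T' := Finset.univ.filter fun v => π v ∈ T with hT'
  have memT' : ∀ v, v ∈ T' ↔ π v ∈ T := fun v => by simp [hT']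
  have half' : IsHalf σ T' := fun v => by
    rw [memT', memT', ← comm, hT.half]
  have leave' : ∀ p ∈ T', ∀ q, q ∉ T' → A p q → (p = π x ∧ q = u) ∨ (p = σ u ∧ q = π (σ x)) := by
    intro p hp q hq hpq
    rw [memT'] at hp hq
    have e : ∀ {z w : V}, π z = w → z = π w := fun H => by rw [← H, πinv]
    rcases hT.leave _ hp _ hq (πA hpq) with ⟨h₁, h₂⟩ | ⟨h₁, h₂⟩
    · exact .inl ⟨e h₁, (e h₂).trans πu⟩
    · refine .inr ⟨?_, e h₂⟩
      rw [e h₁, ← comm, πu]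
  have huD : u ∈ (T ∪ T')ᶜ := by simp [memT', πu, hT.head]
  have enter : ∀ p, p ∉ (T ∪ T')ᶜ → ∀ q ∈ (T ∪ T')ᶜ, A p q → q = u ∧ (p = x ∨ p = π x) := by
    intro p hp q hq hpq
    simp only [Finset.mem_compl, Finset.mem_union, not_or, not_not, not_and_or] at hp hq
    rcases hp with hp | hp
    · rcases hT.leave p hp q hq.1 hpq with H | ⟨_, rfl⟩
      · exact ⟨H.2, .inl H.1⟩
      · exact absurd ((half' x).2 (by rwa [memT'])) hq.2
    · rcases leave' p hp q hq.2 hpq with H | ⟨_, rfl⟩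
      · exact ⟨H.2, .inr H.1⟩
      · rw [← comm, hT.half] at hq
        exact absurd hπxT hq.1
  have hR : IsRooted A σ (T ∪ T')ᶜ u := by
    refine hσ.isRooted (uσ u) huD (fun v hv => ?_) (fun p hp q hq hpq => (enter p hp q hq hpq).1)
    have : v ∉ T := fun H => Finset.mem_compl.1 hv (Finset.mem_union_left _ H)
    simp [hT.half v, this]
  have hD := hR.sum_deg_le hσ πx.symm (by simp [hT.tail]) (by simp [memT', πinv, hT.tail]) hxu
    hπxu (fun p hp hpu => (enter p hp u huD hpu).2)
  have hcard : ∑ v ∈ T ∩ T', 1 = ∑ v ∈ (T ∪ T')ᶜ, 1 :=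
    hT.half.sum_inter_eq hσ.inv hσ.inv half' (fun _ => rfl) (fun _ => rfl)
  have hdeg : ∑ v ∈ T ∩ T', (inD A v + outD A v) = _ :=
    hT.half.sum_inter_eq hσ.inv hσ.inv half' hσ.deg_map hσ.deg_map
  have hrest : ∑ v ∈ (T ∪ T') \ (T ∩ T'), (inD A v + outD A v) =
      ∑ v ∈ (T ∪ T') \ (T ∩ T'), 2 := by
    refine Finset.sum_congr rfl fun v hv => ?_
    have hvM : σ v ≠ τ v := fun H => by
      simp [memT', (πfix v).2 H] at hv
    rw [hin v hvM, hout v hvM]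
  have s₁ := Finset.sum_add_sum_compl (T ∪ T') (fun v => inD A v + outD A v)
  have s₂ := Finset.sum_sdiff (f := fun v => inD A v + outD A v)
    (Finset.inter_subset_union (s := T) (t := T'))
  have c₁ := Finset.card_add_card_compl (T ∪ T')
  have c₂ := Finset.card_sdiff_add_card_eq_card (Finset.inter_subset_union (s := T) (t := T'))
  have := sum_inD_univ (A := A)
  simp only [Finset.sum_const, smul_eq_mul, mul_one] at hcard hrest
  rw [Finset.sum_add_distrib (s := Finset.univ)] at s₁
  omega

end SkewMU

section Transport

variable {W : Type*} {B : W → W → Prop} {ρ : W → W}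

lemma SkewMU.transport (h : SkewMU B ρ) (e : V ≃ W) (he : ∀ a b, A a b ↔ B (e a) (e b)) :
    SkewMU A (fun v => e.symm (ρ (e v))) where
  inv v := by simp [h.inv]
  ne v hv := h.ne (e v) (by simpa using congrArg e hv)
  skew a b hab := by
    rw [he] at hab ⊢
    simpa using h.skew _ _ hab
  unsat T hT := by
    obtain ⟨p, hp, q, hq, hpq⟩ := h.unsat (T.map e.toEmbedding) (by
      intro w
      have := hT (e.symm w)
      simp only [Equiv.apply_symm_apply] at this
      simpa [Finset.mem_map_equiv] using this)
    rw [Finset.mem_map_equiv] at hp hq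
    exact ⟨_, hp, _, hq, by rw [he]; simpa using hpq⟩
  crit a b hab := by
    obtain ⟨T, hT⟩ := h.crit _ _ ((he a b).1 hab)
    refine ⟨T.map e.symm.toEmbedding, ?_, ?_, ?_, ?_⟩
    · intro v
      simpa [Finset.mem_map_equiv] using hT.half (e v)
    · simpa [Finset.mem_map_equiv] using hT.tail
    · simpa [Finset.mem_map_equiv] using hT.head
    · intro p hp q hq hpq
      simp only [Finset.mem_map_equiv, Equiv.symm_symm] at hp hq
      simpa [Equiv.eq_symm_apply] using hT.leave _ hp _ hq ((he p q).1 hpq)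
  inc v := by
    obtain ⟨w, hw⟩ := h.inc (e v)
    exact ⟨e.symm w, by simpa [he] using hw⟩

lemma SkewMU.Dense.transport [Fintype V] [Fintype W] (h : SkewMU.Dense B ρ) (e : V ≃ W)
    (he : ∀ a b, A a b ↔ B (e a) (e b)) : SkewMU.Dense A (fun v => e.symm (ρ (e v))) := by
  have hin : ∀ v, inD A v = inD B (e v) := fun v =>
    Finset.card_equiv e fun u => by simp [he]
  have hunit : (Finset.univ.filter fun v => A (e.symm (ρ (e v))) v).card =
      (Finset.univ.filter fun w => B (ρ w) w).card :=
    Finset.card_equiv e fun u => by simp [he]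
  rw [SkewMU.Dense, hunit, Fintype.card_congr e]
  simp only [hin]
  rw [Equiv.sum_comp e (inD B)]
  exact h

end Transport

end SkewDigraph

section ClauseSets

variable {F F' : Finset (Finset Lit)}

@[simp] lemma Lit.compl_compl (x : Lit) : x.compl.compl = x := by simp [Lit.compl]

lemma Lit.compl_ne (x : Lit) : x.compl ≠ x := fun h => by
  simpa [Lit.compl] using congrArg Prod.snd h

lemma Lit.compl_inj {x y : Lit} : x.compl = y.compl ↔ x = y :=
  ⟨fun h => by rw [← x.compl_compl, h, y.compl_compl], congrArg _⟩

lemma litVal_compl (φ : ℕ → Bool) (x : Lit) : LitVal φ x.compl = !LitVal φ x := by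
  obtain ⟨n, _ | _⟩ := x <;> simp [LitVal, Lit.compl]

lemma mem_litsOf {x : Lit} : x ∈ litsOf F ↔ ∃ C ∈ F, x ∈ C ∨ x.compl ∈ C := by
  obtain ⟨n, b⟩ := x
  simp only [litsOf, varsOf, Finset.mem_product, Finset.mem_biUnion, Finset.mem_image,
    Finset.mem_univ, and_true, Prod.exists, exists_and_right, exists_eq_right, Lit.compl]
  cases b <;> simp [or_comm]

lemma mem_litsOf_of_mem {C : Finset Lit} {x : Lit} (hC : C ∈ F) (hx : x ∈ C) : x ∈ litsOf F :=
  mem_litsOf.2 ⟨C, hC, .inl hx⟩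

/-- The arcs of the implication digraph, as a relation on the literals. -/
def idgRel (F : Finset (Finset Lit)) (a b : {x // x ∈ litsOf F}) : Prop :=
  insert (Lit.compl a) {(b : Lit)} ∈ F

/-- Complementation on the literals of a clause-set. -/
def idgCompl (F : Finset (Finset Lit)) (a : {x // x ∈ litsOf F}) : {x // x ∈ litsOf F} :=
  ⟨Lit.compl a, compl_mem a.2⟩

lemma MU2.exists_eq (hF : MU2 F) (h0 : ∅ ∉ F) {C : Finset Lit} (hC : C ∈ F) :
    ∃ a b : {x // x ∈ litsOf F}, C = insert (Lit.compl a) {(b : Lit)} := by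
  have key : ∀ x ∈ C, ∀ y ∈ C, C = {x, y} →
      ∃ a b : {x // x ∈ litsOf F}, C = insert (Lit.compl a) {(b : Lit)} := fun x hx y hy h =>
    ⟨⟨x.compl, compl_mem (mem_litsOf_of_mem hC hx)⟩, ⟨y, mem_litsOf_of_mem hC hy⟩, by
      simpa using h⟩
  have h1 : C.card ≠ 0 := fun h => h0 (Finset.card_eq_zero.1 h ▸ hC)
  have h2 := hF.2 C hC
  obtain h | h : C.card = 1 ∨ C.card = 2 := by omega
  · obtain ⟨x, rfl⟩ := Finset.card_eq_one.1 h
    exact key x (by simp) x (by simp) (by simp)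
  · obtain ⟨x, y, _, rfl⟩ := Finset.card_eq_two.1 h
    exact key x (by simp) y (by simp) rfl

lemma MU2.empty_notMem (hF : MU2 F) {k : ℕ} (hk : 2 ≤ k) (hd : deficiency F = k) : ∅ ∉ F := by
  intro h0
  have hF1 : F = {∅} := by
    by_contra hne
    obtain ⟨φ, hφ⟩ := hF.1.2.2 {∅} (Finset.ssubset_iff_subset_ne.2 ⟨by simpa using h0, Ne.symm hne⟩)
    simpa using hφ ∅ (by simp)
  rw [hF1] at hd
  simp [deficiency, varsOf] at hd
  omega

lemma MU2.skewMU (hF : MU2 F) (h0 : ∅ ∉ F) : SkewMU (idgRel F) (idgCompl F) where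
  inv v := by simp [idgCompl]
  ne v hv := Lit.compl_ne v (congrArg Subtype.val hv)
  skew a b hab := by
    simp only [idgRel, idgCompl, Lit.compl_compl] at hab ⊢
    rwa [Finset.pair_comm]
  unsat T hT := by
    by_contra! H
    classical
    let φ : ℕ → Bool := fun n => decide (∃ h, (⟨(n, true), h⟩ : {x // x ∈ litsOf F}) ∈ T)
    have hφ : ∀ x ∈ T, LitVal φ x = true := by
      rintro ⟨⟨n, _ | _⟩, hx⟩ hxT
      · simp only [LitVal, Bool.false_eq_true, if_false, φ, Bool.not_eq_true',
          decide_eq_false_iff_not]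
        rintro ⟨h, hn⟩
        exact (hT ⟨(n, true), h⟩).1 hxT hn
      · simpa [LitVal, φ] using ⟨hx, hxT⟩
    refine hF.1.2.1 ⟨φ, fun C hC => ?_⟩
    obtain ⟨a, b, rfl⟩ := hF.exists_eq h0 hC
    by_cases ha : a ∈ T
    · refine ⟨b, by simp, hφ b ?_⟩
      by_contra hb
      exact H a ha b hb hC
    · exact ⟨Lit.compl a, by simp, hφ (idgCompl F a) ((hT a).2 ha)⟩
  crit a b hab := by
    classical
    obtain ⟨φ, hφ⟩ := hF.1.2.2 _ (Finset.erase_ssubset hab)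
    have hn : ¬ ∃ x ∈ insert (Lit.compl a) {(b : Lit)}, LitVal φ x = true := fun hx =>
      hF.1.2.1 ⟨φ, fun C hC => by
        by_cases h : C = insert (Lit.compl a) {(b : Lit)}
        · rwa [h]
        · exact hφ C (Finset.mem_erase.2 ⟨h, hC⟩)⟩
    simp only [Finset.mem_insert, Finset.mem_singleton, exists_eq_or_imp, exists_eq_left,
      litVal_compl, not_or] at hn
    refine ⟨Finset.univ.filter fun x => LitVal φ x = true, ?_, ?_, ?_, ?_⟩
    · intro v
      simp [idgCompl, litVal_compl]
    · simpa using hn.1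
    · simpa using hn.2
    · intro p hp q hq hpq
      simp only [Finset.mem_filter, Finset.mem_univ, true_and] at hp hq
      have heq : (insert (Lit.compl p) {(q : Lit)} : Finset Lit) =
          insert (Lit.compl a) {(b : Lit)} := by
        by_contra hne
        obtain ⟨x, hx, hxφ⟩ := hφ _ (Finset.mem_erase.2 ⟨hne, hpq⟩)
        simp only [Finset.mem_insert, Finset.mem_singleton] at hx
        rcases hx with rfl | rfl
        · simp [litVal_compl, hp] at hxφ
        · exact hq hxφ
      have hset := congrArg (fun S : Finset Lit => (S : Set Lit)) heq
      simp only [Finset.coe_insert, Finset.coe_singleton, Set.pair_eq_pair_iff] at hset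
      rcases hset with ⟨h₁, h₂⟩ | ⟨h₁, h₂⟩
      · exact .inl ⟨Subtype.ext (Lit.compl_inj.1 h₁), Subtype.ext h₂⟩
      · exact .inr ⟨Subtype.ext (by simp [idgCompl, ← h₁]), Subtype.ext h₂⟩
  inc v := by
    obtain ⟨C, hC, hv⟩ := mem_litsOf.1 v.2
    obtain ⟨a, b, rfl⟩ := hF.exists_eq h0 hC
    have hC' : insert (b : Lit) {Lit.compl a} ∈ F := by rwa [Finset.pair_comm]
    simp only [Finset.mem_insert, Finset.mem_singleton, Lit.compl_inj] at hv
    simp only [idgRel]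
    rcases hv with (hv | hv) | (hv | hv)
    · exact ⟨idgCompl F b, .inr (by simpa [idgCompl, hv] using hC')⟩
    · exact ⟨a, .inr (by rwa [hv])⟩
    · exact ⟨b, .inl (by rwa [hv])⟩
    · exact ⟨idgCompl F a, .inl (by rwa [hv])⟩

lemma MU2.dense (hF : MU2 F) (h0 : ∅ ∉ F) {k : ℕ} (hk : 2 ≤ k) (hd : deficiency F = k) :
    SkewMU.Dense (idgRel F) (idgCompl F) := by
  classical
  have hV : Fintype.card {x // x ∈ litsOf F} = (varsOf F).card * 2 := by
    rw [Fintype.card_coe, litsOf, Finset.card_product, Finset.card_univ, Fintype.card_bool]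
  have hc : F.card = (varsOf F).card + k := by
    unfold deficiency at hd; omega
  have harcs : ∑ v, inD (idgRel F) v = ∑ C ∈ F, ((Finset.univ.filter
      fun e : {x // x ∈ litsOf F} × {x // x ∈ litsOf F} => idgRel F e.1 e.2).filter
      fun e => insert (Lit.compl e.1) {(e.2 : Lit)} = C).card := by
    rw [sum_inD, ← Finset.card_eq_sum_card_fiberwise]
    · simp
    · intro e he
      exact (Finset.mem_filter.1 he).2
  have hunits : (Finset.univ.filter fun v => idgRel F (idgCompl F v) v).card =
      ∑ C ∈ F, ((Finset.univ.filter fun v => idgRel F (idgCompl F v) v).filter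
      fun v : {x // x ∈ litsOf F} => {(v : Lit)} = C).card := by
    rw [← Finset.card_eq_sum_card_fiberwise]
    intro v hv
    simpa only [idgRel, idgCompl, Lit.compl_compl, Finset.pair_eq_singleton, Finset.mem_coe] using
      (Finset.mem_filter.1 hv).2
  have hfib : F.card * 2 ≤ ∑ v, inD (idgRel F) v +
      (Finset.univ.filter fun v => idgRel F (idgCompl F v) v).card := by
    rw [harcs, hunits, ← Finset.sum_add_distrib, ← smul_eq_mul]
    refine Finset.card_nsmul_le_sum _ _ _ fun C hC => ?_
    obtain ⟨a, b, rfl⟩ := hF.exists_eq h0 hC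
    have mem_arcs : ∀ {e : {x // x ∈ litsOf F} × {x // x ∈ litsOf F}} {C : Finset Lit},
        idgRel F e.1 e.2 → insert (Lit.compl e.1) {(e.2 : Lit)} = C → e ∈ (Finset.univ.filter
          fun e : {x // x ∈ litsOf F} × {x // x ∈ litsOf F} => idgRel F e.1 e.2).filter
          fun e => insert (Lit.compl e.1) {(e.2 : Lit)} = C := fun h₁ h₂ =>
      Finset.mem_filter.2 ⟨Finset.mem_filter.2 ⟨Finset.mem_univ _, h₁⟩, h₂⟩
    by_cases hab : Lit.compl a = b
    · refine Nat.add_le_add (a := 1) (c := 1) (Finset.card_pos.2 ⟨(a, b), ?_⟩)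
        (Finset.card_pos.2 ⟨b, ?_⟩)
      · exact mem_arcs hC rfl
      · refine Finset.mem_filter.2 ⟨Finset.mem_filter.2 ⟨Finset.mem_univ _, ?_⟩, ?_⟩
        · simpa [idgRel, idgCompl, hab] using hC
        · simp [hab]
    · refine le_add_right (Finset.one_lt_card.2
        ⟨(a, b), mem_arcs hC rfl, (idgCompl F b, idgCompl F a), mem_arcs ?_ ?_, fun H => ?_⟩)
      · simpa [idgRel, idgCompl, Finset.pair_comm] using hC
      · simp [idgCompl, Finset.pair_comm]
      · exact hab (congrArg (fun e => ((e.2 : {x // x ∈ litsOf F}) : Lit)) H).symm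
  unfold SkewMU.Dense
  omega

lemma mem_idg {a b : Lit} : (a, b) ∈ (idg F).E ↔
    a ∈ litsOf F ∧ b ∈ litsOf F ∧ insert (Lit.compl a) {b} ∈ F := by
  simp [idg, and_assoc]

/-- A clause-set isomorphism is an isomorphism of implication digraphs. -/
lemma CNFIso.digraphIso {f : Lit → Lit} (hf : CNFIso F F' f) :
    DigraphIso (idg F) (idg F') f := by
  obtain ⟨hbij, hcompl, himg⟩ := hf
  refine ⟨hbij, ?_⟩
  ext ⟨p, q⟩
  rw [Finset.mem_image, mem_idg]
  constructor
  · rintro ⟨⟨a, b⟩, h, heq⟩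
    obtain ⟨ha, hb, hab⟩ := mem_idg.1 h
    obtain ⟨rfl, rfl⟩ := Prod.mk.inj heq
    refine ⟨hbij.mapsTo ha, hbij.mapsTo hb, ?_⟩
    rw [← himg]
    refine Finset.mem_image.2 ⟨_, hab, ?_⟩
    rw [Finset.image_insert, Finset.image_singleton, hcompl a ha]
  · rintro ⟨hp, hq, hpq⟩
    obtain ⟨a, ha, rfl⟩ := hbij.surjOn hp
    obtain ⟨b, hb, rfl⟩ := hbij.surjOn hq
    refine ⟨(a, b), mem_idg.2 ⟨ha, hb, ?_⟩, rfl⟩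
    rw [← himg, ← hcompl a ha] at hpq
    obtain ⟨C, hC, hCimg⟩ := Finset.mem_image.1 hpq
    suffices C = insert (Lit.compl a) {b} from this ▸ hC
    have hmem : ∀ x ∈ litsOf F, f x ∈ C.image f → x ∈ C := fun x hx hfx => by
      obtain ⟨y, hy, hyx⟩ := Finset.mem_image.1 hfx
      rwa [← hbij.injOn (mem_litsOf_of_mem hC hy) hx hyx]
    apply Finset.Subset.antisymm
    · intro x hx
      have hfx := Finset.mem_image_of_mem f hx
      have hxF := mem_litsOf_of_mem hC hx
      rw [hCimg, Finset.mem_insert, Finset.mem_singleton] at hfx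
      rw [Finset.mem_insert, Finset.mem_singleton]
      exact hfx.imp (hbij.injOn hxF (compl_mem ha)) (hbij.injOn hxF hb)
    · rw [Finset.insert_subset_iff, Finset.singleton_subset_iff]
      exact ⟨hmem _ (compl_mem ha) (by simp [hCimg]), hmem _ hb (by simp [hCimg])⟩

/-- In deficiency at least two, isomorphisms of implication digraphs commute with
complementation. -/
lemma DigraphIso.cnfIso {f : Lit → Lit} (hf : DigraphIso (idg F) (idg F') f) (hF : MU2 F)
    (hF' : MU2 F') {k k' : ℕ} (hk : 2 ≤ k) (hk' : 2 ≤ k') (hd : deficiency F = k)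
    (hd' : deficiency F' = k') : CNFIso F F' f := by
  obtain ⟨hbij, himg⟩ := hf
  change Set.BijOn f (litsOf F) (litsOf F') at hbij
  have h0 := hF.empty_notMem hk hd
  have h0' := hF'.empty_notMem hk' hd'
  have hA : ∀ a ∈ litsOf F, ∀ b ∈ litsOf F,
      insert (Lit.compl a) {b} ∈ F ↔ insert (Lit.compl (f a)) {f b} ∈ F' := by
    intro a ha b hb
    have h₁ : (f a, f b) ∈ (idg F').E ↔ (a, b) ∈ (idg F).E := by
      rw [← himg, Finset.mem_image]
      constructor
      · rintro ⟨⟨x, y⟩, hxy, h⟩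
        have hxy' := mem_idg.1 hxy
        rw [Prod.mk.injEq] at h
        rwa [← hbij.injOn hxy'.1 ha h.1, ← hbij.injOn hxy'.2.1 hb h.2]
      · exact fun h => ⟨_, h, rfl⟩
    have ha' : f a ∈ litsOf F' := hbij.mapsTo ha
    have hb' : f b ∈ litsOf F' := hbij.mapsTo hb
    simpa [mem_idg, ha, hb, ha', hb'] using h₁.symm
  let e : {x // x ∈ litsOf F} ≃ {x // x ∈ litsOf F'} := hbij.equiv f
  have he : ∀ a b, idgRel F a b ↔ idgRel F' (e a) (e b) := fun a b => hA a a.2 b b.2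
  have hcompl : ∀ x ∈ litsOf F, f (Lit.compl x) = Lit.compl (f x) := fun x hx => by
    have H := (hF.skewMU h0).symm_unique ((hF'.skewMU h0').transport e he)
      (hF.dense h0 hk hd) ((hF'.dense h0' hk' hd').transport e he) ⟨x, hx⟩
    exact congrArg Subtype.val ((Equiv.eq_symm_apply e).1 H)
  refine ⟨hbij, hcompl, ?_⟩
  have hclause : ∀ a ∈ litsOf F, ∀ b, (insert (Lit.compl a) {b} : Finset Lit).image f =
      insert (Lit.compl (f a)) {f b} := fun a ha b => by
    rw [Finset.image_insert, Finset.image_singleton, hcompl a ha]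
  ext C'
  rw [Finset.mem_image]
  constructor
  · rintro ⟨C, hC, rfl⟩
    obtain ⟨a, b, rfl⟩ := hF.exists_eq h0 hC
    rw [hclause a a.2]
    exact (hA a a.2 b b.2).1 hC
  · intro hC'
    obtain ⟨⟨a', ha'⟩, ⟨b', hb'⟩, rfl⟩ := hF'.exists_eq h0' hC'
    obtain ⟨a, ha, rfl⟩ := hbij.surjOn ha'
    obtain ⟨b, hb, rfl⟩ := hbij.surjOn hb'
    exact ⟨_, (hA a ha b hb).2 hC', hclause a ha b⟩

end ClauseSets

theorem stmt1 (k : ℕ) (hk : 2 ≤ k) (F F' : Finset (Finset Lit)) (hF : MU2 F) (hF' : MU2 F')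
    (hdF : deficiency F = (k : ℤ)) (hdF' : deficiency F' = (k : ℤ)) :
    (∃ f, CNFIso F F' f) ↔ (∃ f, DigraphIso (idg F) (idg F') f) :=
  ⟨fun ⟨f, hf⟩ => ⟨f, hf.digraphIso⟩,
    fun ⟨f, hf⟩ => ⟨f, hf.cnfIso hF hF' hk hk hdF hdF'⟩⟩
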